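/- Let I ⊆ K[X][U] be an ideal. Every weight vector of the form (0,…,0,ω̄) with ω̄ ∈ ℝ^m_{≥0} (i.e., every element of Ω_u := {ω ∈ Ω : ω_1 = … = ω_n = 0}) is an I-specific elimination vector: it lies in C_≺(I) for some I-specific elimination order ≺ for U. -/

import Mathlib

open MvPolynomial

/-- A monomial order on exponent vectors in `Fin N →₀ ℕ`:
a linear order compatible with addition in which `0` is the least element. -/
structure MonoOrder (N : ℕ) where
  lt : (Fin N →₀ ℕ) → (Fin N →₀ ℕ) → Prop
  total : ∀ a b, a = b ∨ lt a b ∨ lt b a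
  trans : ∀ a b c, lt a b → lt b c → lt a c
  irrefl : ∀ a, ¬ lt a a
  add_right : ∀ a b c, lt a b → lt (a + c) (b + c)
  zero_lt : ∀ a, a ≠ 0 → lt 0 a

variable {N : ℕ} {K : Type*} [Field K]

/-- The ω-degree `ω · d` of an exponent vector `d`. -/
noncomputable def wdeg (ω : Fin N → ℝ) (d : Fin N → ℕ) : ℝ :=
  ∑ i, ω i * (d i : ℝ)

/-- The ≺-maximal exponent in the support of `p` (the exponent of the leading term). -/
noncomputable def leadExp (mo : MonoOrder N) (p : MvPolynomial (Fin N) K) : Fin N →₀ ℕ :=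
  open Classical in
  if h : ∃ d ∈ p.support, ∀ e ∈ p.support, e ≠ d → mo.lt e d then h.choose else 0

/-- The leading term `lt_≺(p)` of `p` w.r.t. the monomial order `mo`. -/
noncomputable def leadTerm (mo : MonoOrder N) (p : MvPolynomial (Fin N) K) :
    MvPolynomial (Fin N) K :=
  monomial (leadExp mo p) (p.coeff (leadExp mo p))

/-- `p ∈ K[X]`: the polynomial `p` involves only the first `n` variables. -/
def inKX (n : ℕ) (p : MvPolynomial (Fin N) K) : Prop :=
  ∀ d ∈ p.support, ∀ i : Fin N, n ≤ (i : ℕ) → d i = 0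

open Classical in
/-- Initial form `lt_ω(p)`: the sum of the terms of `p` of maximal ω-degree. -/
noncomputable def initForm (ω : Fin N → ℝ) (p : MvPolynomial (Fin N) K) :
    MvPolynomial (Fin N) K :=
  ∑ d ∈ p.support.filter (fun d : Fin N →₀ ℕ => ∀ e ∈ p.support, wdeg ω ⇑e ≤ wdeg ω ⇑d),
    monomial d (p.coeff d)

/-- The initial ideal `⟨lt_ω(I)⟩` w.r.t. a weight vector ω. -/
noncomputable def ltIdealW (ω : Fin N → ℝ) (I : Ideal (MvPolynomial (Fin N) K)) :
    Ideal (MvPolynomial (Fin N) K) :=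
  Ideal.span (initForm ω '' (I : Set (MvPolynomial (Fin N) K)))

/-- The initial ideal `⟨lt_≺(I)⟩` w.r.t. a monomial order. -/
noncomputable def ltIdealO (mo : MonoOrder N) (I : Ideal (MvPolynomial (Fin N) K)) :
    Ideal (MvPolynomial (Fin N) K) :=
  Ideal.span (leadTerm mo '' (I : Set (MvPolynomial (Fin N) K)))

/-- The Gröbner cone `C_≺(I)`. -/
noncomputable def gCone (mo : MonoOrder N) (I : Ideal (MvPolynomial (Fin N) K)) :
    Set (Fin N → ℝ) :=
  closure {ω | (∀ i, 0 ≤ ω i) ∧ ltIdealW ω I = ltIdealO mo I}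

/-- `G` is the normed reduced Gröbner basis of `I` w.r.t. `mo`. -/
def IsRedGB (mo : MonoOrder N) (I : Ideal (MvPolynomial (Fin N) K))
    (G : Set (MvPolynomial (Fin N) K)) : Prop :=
  G.Finite ∧ G ⊆ (I : Set (MvPolynomial (Fin N) K)) ∧
  Ideal.span (leadTerm mo '' G) = ltIdealO mo I ∧
  (∀ g ∈ G, g ≠ 0 ∧ g.coeff (leadExp mo g) = 1) ∧
  (∀ g ∈ G, ∀ h ∈ G, g ≠ h → ∀ d ∈ h.support, ¬ leadExp mo g ≤ d)

/-- `mo` is an `I`-specific elimination order for the last variables: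
every element of the reduced Gröbner basis whose leading term lies in `K[X]`
lies itself in `K[X]`. -/
def IsEO (n : ℕ) (mo : MonoOrder N) (I : Ideal (MvPolynomial (Fin N) K)) : Prop :=
  ∀ G : Set (MvPolynomial (Fin N) K), IsRedGB mo I G →
    ∀ g ∈ G, inKX n (leadTerm mo g) → inKX n g

/-- `ω` is an `I`-specific elimination vector. -/
def IsEV (n : ℕ) (I : Ideal (MvPolynomial (Fin N) K)) (ω : Fin N → ℝ) : Prop :=
  (∀ i, 0 ≤ ω i) ∧ ∃ mo : MonoOrder N, IsEO n mo I ∧ ω ∈ gCone mo I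

/-- The monomial order `mo` refines the weight vector `ω`. -/
def Refines (mo : MonoOrder N) (ω : Fin N → ℝ) : Prop :=
  ∀ d e : Fin N →₀ ℕ, wdeg ω ⇑d < wdeg ω ⇑e → mo.lt d e

/-- `Ω_u`: the set of weight vectors vanishing on the first `n` coordinates. -/
def OmegaU (n N : ℕ) : Set (Fin N → ℝ) :=
  {ω | (∀ i, 0 ≤ ω i) ∧ ∀ i : Fin N, (i : ℕ) < n → ω i = 0}

/-- `L_{X,≺}(G)`: the elements of `G` whose leading term lies in `K[X]`. -/
def LXset (n : ℕ) (mo : MonoOrder N) (G : Set (MvPolynomial (Fin N) K)) :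
    Set (MvPolynomial (Fin N) K) :=
  {p ∈ G | inKX n (leadTerm mo p)}
lemma castAdd_inj (n m : ℕ) : Function.Injective (Fin.castAdd m : Fin n → Fin (n + m)) := by
  intro a b h
  exact Fin.ext (by simpa using congrArg Fin.val h)

/-- Extend an exponent vector on the first `n` variables to all `n + m` variables. -/
noncomputable def extExp (n m : ℕ) (a : Fin n →₀ ℕ) : Fin (n + m) →₀ ℕ :=
  Finsupp.mapDomain (Fin.castAdd m) a

/-- The restriction of a monomial order on `K[X][U]` to the monomials of `K[X]`. -/
noncomputable def restrictOrder (n m : ℕ) (mo : MonoOrder (n + m)) : MonoOrder n where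
  lt a b := mo.lt (extExp n m a) (extExp n m b)
  total a b := by
    rcases mo.total (extExp n m a) (extExp n m b) with h | h | h
    · exact Or.inl (Finsupp.mapDomain_injective (castAdd_inj n m) h)
    · exact Or.inr (Or.inl h)
    · exact Or.inr (Or.inr h)
  trans a b c hab hbc := mo.trans _ _ _ hab hbc
  irrefl a := mo.irrefl _
  add_right a b c h := by
    show mo.lt (extExp n m (a + c)) (extExp n m (b + c))
    rw [show extExp n m (a + c) = extExp n m a + extExp n m c from Finsupp.mapDomain_add,
        show extExp n m (b + c) = extExp n m b + extExp n m c from Finsupp.mapDomain_add]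
    exact mo.add_right _ _ _ h
  zero_lt a ha := by
    show mo.lt (extExp n m 0) (extExp n m a)
    have h0 : extExp n m (0 : Fin n →₀ ℕ) = 0 := Finsupp.mapDomain_zero
    rw [h0]
    refine mo.zero_lt _ (fun h => ha ?_)
    exact Finsupp.mapDomain_injective (castAdd_inj n m) (h.trans h0.symm)

/-- The projection `K[X][U] → K[X]` sending each `u`-variable to `0`;
on polynomials of `K[X]` it inverts the canonical inclusion `K[X] → K[X][U]`. -/
noncomputable def projX (n m : ℕ) (K : Type*) [Field K] :
    MvPolynomial (Fin (n + m)) K →ₐ[K] MvPolynomial (Fin n) K :=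
  aeval (fun i : Fin (n + m) => if h : (i : ℕ) < n then X ⟨(i : ℕ), h⟩ else 0)

/-- The elimination ideal `I ∩ K[X]`, viewed as an ideal of `K[x_1,…,x_n]` via the
canonical inclusion `K[X] → K[X][U]`. -/
noncomputable def elimIdeal (n m : ℕ) {K : Type*} [Field K]
    (I : Ideal (MvPolynomial (Fin (n + m)) K)) : Ideal (MvPolynomial (Fin n) K) :=
  Ideal.comap
    (rename (Fin.castAdd m) : MvPolynomial (Fin n) K →ₐ[K] MvPolynomial (Fin (n + m)) K) I

/-- Priority of the variables for the lex order `u_1 ≻ … ≻ u_m ≻ x_1 ≻ … ≻ x_n`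
(smaller priority value = more significant variable). -/
def uPrio (n m : ℕ) (i : Fin (n + m)) : ℕ :=
  if (i : ℕ) < n then m + (i : ℕ) else (i : ℕ) - n

/-- The pure lexicographic order with `u_1 ≻ … ≻ u_m ≻ x_1 ≻ … ≻ x_n`:
`a <_lex b` iff at the most significant position where they differ, `a` is smaller. -/
def uLexLt (n m : ℕ) (a b : Fin (n + m) →₀ ℕ) : Prop :=
  ∃ i : Fin (n + m), a i < b i ∧ ∀ j : Fin (n + m), uPrio n m j < uPrio n m i → a j = b j

open Filter Topology

namespace MonoOrder

theorem asymm (mo : MonoOrder N) {a b : Fin N →₀ ℕ} (h : mo.lt a b) : ¬ mo.lt b a :=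
  fun h' => mo.irrefl _ (mo.trans _ _ _ h h')

theorem eq_or_lt_of_le (mo : MonoOrder N) {a b : Fin N →₀ ℕ} (h : a ≤ b) :
    a = b ∨ mo.lt a b := by
  obtain ⟨c, rfl⟩ := exists_add_of_le h
  by_cases hc : c = 0
  · simp [hc]
  · right
    simpa [add_comm] using mo.add_right 0 c a (mo.zero_lt c hc)

theorem wellFounded (mo : MonoOrder N) : WellFounded mo.lt := by
  rw [wellFounded_iff_isEmpty_descending_chain]
  refine ⟨fun ⟨f, hf⟩ => ?_⟩
  have hdesc : ∀ k l, k < l → mo.lt (f l) (f k) := by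
    intro k l hkl
    induction l, hkl using Nat.le_induction with
    | base => exact hf k
    | succ l _ ih => exact mo.trans _ _ _ (hf l) ih
  obtain ⟨k, l, hkl, hle⟩ := wellQuasiOrdered_le f
  rcases mo.eq_or_lt_of_le hle with h | h
  · exact mo.irrefl (f l) (by simpa [h] using hdesc k l hkl)
  · exact mo.asymm h (hdesc k l hkl)

theorem exists_greatest (mo : MonoOrder N) {s : Finset (Fin N →₀ ℕ)} (hs : s.Nonempty) :
    ∃ d ∈ s, ∀ e ∈ s, e ≠ d → mo.lt e d := by
  induction hs using Finset.Nonempty.cons_induction with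
  | singleton a => exact ⟨a, by simp, by simp⟩
  | cons a s ha hs ih =>
    obtain ⟨d, hd, hmax⟩ := ih
    rcases mo.total a d with rfl | h | h
    · exact absurd hd ha
    · refine ⟨d, by simp [hd], fun e he hne => ?_⟩
      rcases Finset.mem_cons.1 he with rfl | he
      · exact h
      · exact hmax e he hne
    · refine ⟨a, by simp, fun e he hne => ?_⟩
      rcases Finset.mem_cons.1 he with rfl | he
      · exact absurd rfl hne
      · by_cases hed : e = d
        · exact hed ▸ h
        · exact mo.trans _ _ _ (hmax e he hed) h

end MonoOrder

theorem leadExp_spec (mo : MonoOrder N) {p : MvPolynomial (Fin N) K} (hp : p ≠ 0) :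
    leadExp mo p ∈ p.support ∧ ∀ e ∈ p.support, e ≠ leadExp mo p → mo.lt e (leadExp mo p) := by
  have h : ∃ d ∈ p.support, ∀ e ∈ p.support, e ≠ d → mo.lt e d :=
    mo.exists_greatest (by simpa using hp)
  unfold leadExp
  rw [dif_pos h]
  exact h.choose_spec

theorem exists_finset_leadExp_le (mo : MonoOrder N) (I : Ideal (MvPolynomial (Fin N) K)) :
    ∃ T : Finset (MvPolynomial (Fin N) K), (∀ g ∈ T, g ∈ I ∧ g ≠ 0) ∧
      ∀ f ∈ I, f ≠ 0 → ∃ g ∈ T, leadExp mo g ≤ leadExp mo f := by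
  classical
  set E : Set (Fin N →₀ ℕ) := {d | ∃ f ∈ I, f ≠ 0 ∧ leadExp mo f = d}
  have hfin : {d | Minimal (· ∈ E) d}.Finite :=
    WellQuasiOrderedLE.finite_of_isAntichain (setOfPred_minimal_antichain _)
  have hch : ∀ d ∈ {d | Minimal (· ∈ E) d}, ∃ f ∈ I, f ≠ 0 ∧ leadExp mo f = d :=
    fun d hd => hd.prop
  choose! F hFI hF0 hFd using hch
  refine ⟨hfin.toFinset.image F, ?_, ?_⟩
  · intro g hg
    obtain ⟨d, hd, rfl⟩ := Finset.mem_image.1 hg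
    have hd := hfin.mem_toFinset.1 hd
    exact ⟨hFI d hd, hF0 d hd⟩
  · intro f hf hf0
    obtain ⟨d, hdle, hd⟩ := exists_minimal_le_of_wellFoundedLT (· ∈ E) (leadExp mo f)
      ⟨f, hf, hf0, rfl⟩
    exact ⟨F d, Finset.mem_image_of_mem _ (hfin.mem_toFinset.2 hd), (hFd d hd).trans_le hdle⟩

theorem wdeg_add (ω : Fin N → ℝ) (a b : Fin N →₀ ℕ) :
    wdeg ω ⇑(a + b) = wdeg ω ⇑a + wdeg ω ⇑b := by
  simp [wdeg, mul_add, Finset.sum_add_distrib]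

open Classical in
theorem coeff_initForm (ω : Fin N → ℝ) (p : MvPolynomial (Fin N) K) (d : Fin N →₀ ℕ) :
    (initForm ω p).coeff d =
      if d ∈ p.support ∧ ∀ e ∈ p.support, wdeg ω ⇑e ≤ wdeg ω ⇑d then p.coeff d else 0 := by
  simp [initForm, coeff_sum, coeff_monomial]

theorem initForm_eq_leadTerm (mo : MonoOrder N) {ω : Fin N → ℝ} {g : MvPolynomial (Fin N) K}
    (hg : g ≠ 0)
    (h : ∀ e ∈ g.support, e ≠ leadExp mo g → wdeg ω ⇑e < wdeg ω ⇑(leadExp mo g)) :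
    initForm ω g = leadTerm mo g := by
  classical
  have hl := (leadExp_spec mo hg).1
  ext d
  rw [coeff_initForm, leadTerm, coeff_monomial]
  by_cases hd : leadExp mo g = d
  · subst hd
    rw [if_pos rfl, if_pos]
    refine ⟨hl, fun e he => ?_⟩
    by_cases hne : e = leadExp mo g
    · rw [hne]
    · exact (h e he hne).le
  · rw [if_neg hd, if_neg]
    rintro ⟨hds, hmax⟩
    exact absurd (h d hds (Ne.symm hd)) (not_lt.2 (hmax _ hl))

/-- Replacing each monomial of `q` by a remainder gives a remainder of `q`. -/
theorem exists_remainder_of_support {I : Ideal (MvPolynomial (Fin N) K)}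
    {M : Set (Fin N →₀ ℕ)} {w : (Fin N →₀ ℕ) → ℝ} (q : MvPolynomial (Fin N) K)
    (h : ∀ d ∈ q.support, ∃ r : MvPolynomial (Fin N) K, monomial d 1 - r ∈ I ∧
      ∀ e ∈ r.support, e ∉ M ∧ (e = d ∨ w e < w d)) :
    ∃ r : MvPolynomial (Fin N) K, q - r ∈ I ∧
      ∀ e ∈ r.support, e ∉ M ∧ ∃ d ∈ q.support, e = d ∨ w e < w d := by
  classical
  choose! r hrI hr using h
  refine ⟨∑ d ∈ q.support, C (q.coeff d) * r d, ?_, ?_⟩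
  · have : q - ∑ d ∈ q.support, C (q.coeff d) * r d
        = ∑ d ∈ q.support, C (q.coeff d) * (monomial d 1 - r d) := by
      simp only [mul_sub, Finset.sum_sub_distrib, C_mul_monomial, mul_one]
      rw [← q.as_sum]
    rw [this]
    exact I.sum_mem fun d hd => I.mul_mem_left _ (hrI d hd)
  · intro e he
    obtain ⟨d, hd, hed⟩ := Finset.mem_biUnion.1 (support_sum he)
    have hed' : e ∈ (r d).support := by
      rw [mem_support_iff, coeff_C_mul] at hed
      exact mem_support_iff.2 (right_ne_zero_of_mul hed)
    exact ⟨(hr d hd e hed').1, d, hd, (hr d hd e hed').2⟩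

/-- Division of a monomial by a Gröbner basis whose leading terms are the unique terms of
maximal weight. -/
theorem exists_monomial_remainder (mo : MonoOrder N) {I : Ideal (MvPolynomial (Fin N) K)}
    {ω : Fin N → ℝ} {T : Finset (MvPolynomial (Fin N) K)} (hT : ∀ g ∈ T, g ∈ I ∧ g ≠ 0)
    (hω : ∀ g ∈ T, ∀ e ∈ g.support, e ≠ leadExp mo g → wdeg ω ⇑e < wdeg ω ⇑(leadExp mo g))
    (d : Fin N →₀ ℕ) :
    ∃ r : MvPolynomial (Fin N) K, monomial d 1 - r ∈ I ∧
      ∀ e ∈ r.support, e ∉ {a | ∃ g ∈ T, leadExp mo g ≤ a} ∧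
        (e = d ∨ wdeg ω ⇑e < wdeg ω ⇑d) := by
  classical
  induction d using mo.wellFounded.induction with
  | _ d ih =>
  by_cases hd : ∃ g ∈ T, leadExp mo g ≤ d
  · obtain ⟨g, hgT, hgd⟩ := hd
    obtain ⟨hgI, hg0⟩ := hT g hgT
    obtain ⟨a, rfl⟩ := exists_add_of_le hgd
    obtain ⟨hl, hmax⟩ := leadExp_spec mo hg0
    set l := leadExp mo g with hldef
    have hc : g.coeff l ≠ 0 := mem_support_iff.1 hl
    set q : MvPolynomial (Fin N) K :=
      monomial (l + a) 1 - monomial a (g.coeff l)⁻¹ * g with hq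
    have hsupp : ∀ e ∈ q.support,
        mo.lt e (l + a) ∧ wdeg ω ⇑e < wdeg ω ⇑(l + a) := by
      intro e he
      rw [mem_support_iff, hq, coeff_sub, coeff_monomial, coeff_monomial_mul'] at he
      by_cases hae : a ≤ e
      · obtain ⟨b, rfl⟩ := exists_add_of_le hae
        rw [add_comm a b] at he ⊢
        by_cases hbl : b = l
        · subst hbl
          simp [hc] at he
        · have hb : b ∈ g.support := by
            rw [mem_support_iff]
            intro hb
            apply he
            rw [if_neg (fun h => hbl (add_right_cancel h).symm)]
            simp [hb]
          refine ⟨mo.add_right _ _ _ (hmax b hb hbl), ?_⟩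
          rw [wdeg_add, wdeg_add]
          have := hω g hgT b hb hbl
          linarith
      · rw [if_neg hae, if_neg] at he
        · simp at he
        · rintro rfl
          exact hae le_add_self
    obtain ⟨r, hrI, hr⟩ := exists_remainder_of_support (w := fun e => wdeg ω ⇑e) q
      fun e he => ih e (hsupp e he).1
    refine ⟨r, ?_, fun e he => ⟨(hr e he).1, Or.inr ?_⟩⟩
    · have h1 : monomial (l + a) 1 - r = (q - r) + monomial a (g.coeff l)⁻¹ * g := by
        rw [hq]; ring
      rw [h1]
      exact I.add_mem hrI (I.mul_mem_left _ hgI)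
    · obtain ⟨-, e', he', h | h⟩ := hr e he
      · exact h ▸ (hsupp e' he').2
      · exact h.trans (hsupp e' he').2
  · refine ⟨monomial d 1, by simp, fun e he => ?_⟩
    obtain rfl : e = d := by simpa using support_monomial_subset he
    exact ⟨hd, Or.inl rfl⟩

theorem ltIdealW_eq_ltIdealO (mo : MonoOrder N) {I : Ideal (MvPolynomial (Fin N) K)}
    {ω : Fin N → ℝ} {T : Finset (MvPolynomial (Fin N) K)} (hT : ∀ g ∈ T, g ∈ I ∧ g ≠ 0)
    (hGB : ∀ f ∈ I, f ≠ 0 → ∃ g ∈ T, leadExp mo g ≤ leadExp mo f)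
    (hω : ∀ g ∈ T, ∀ e ∈ g.support, e ≠ leadExp mo g → wdeg ω ⇑e < wdeg ω ⇑(leadExp mo g)) :
    ltIdealW ω I = ltIdealO mo I := by
  classical
  set M : Set (Fin N →₀ ℕ) := {a | ∃ g ∈ T, leadExp mo g ≤ a} with hM
  have mem_of_support : ∀ J : Ideal (MvPolynomial (Fin N) K), (∀ g ∈ T, leadTerm mo g ∈ J) →
      ∀ p : MvPolynomial (Fin N) K, (∀ d ∈ p.support, d ∈ M) → p ∈ J := by
    intro J hJ p hp
    rw [p.as_sum]
    refine J.sum_mem fun d hd => ?_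
    obtain ⟨g, hg, hgd⟩ := hp d hd
    obtain ⟨a, rfl⟩ := exists_add_of_le hgd
    have hc : g.coeff (leadExp mo g) ≠ 0 :=
      mem_support_iff.1 (leadExp_spec mo (hT g hg).2).1
    have : monomial (leadExp mo g + a) (p.coeff (leadExp mo g + a)) =
        monomial a (p.coeff (leadExp mo g + a) * (g.coeff (leadExp mo g))⁻¹) * leadTerm mo g := by
      rw [leadTerm, monomial_mul, inv_mul_cancel_right₀ hc, add_comm]
    rw [this]
    exact J.mul_mem_left _ (hJ g hg)
  apply le_antisymm
  · refine Ideal.span_le.2 ?_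
    rintro _ ⟨f, hf, rfl⟩
    refine mem_of_support (ltIdealO mo I)
      (fun g hg => Ideal.subset_span ⟨g, (hT g hg).1, rfl⟩) _ fun d hd => ?_
    rw [mem_support_iff, coeff_initForm] at hd
    obtain ⟨⟨hdf, hdmax⟩, -⟩ := ite_ne_right_iff.1 hd
    by_contra hdM
    set fM : MvPolynomial (Fin N) K :=
      ∑ e ∈ f.support.filter (· ∈ M), monomial e (f.coeff e) with hfM
    have hcoeff : ∀ e, fM.coeff e = if e ∈ f.support ∧ e ∈ M then f.coeff e else 0 := by
      intro e
      simp [hfM, coeff_sum, coeff_monomial]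
    have hsupp : ∀ e ∈ fM.support, e ∈ f.support ∧ e ∈ M := by
      intro e he
      rw [mem_support_iff, hcoeff] at he
      exact (ite_ne_right_iff.1 he).1
    obtain ⟨r, hrI, hr⟩ := exists_remainder_of_support (w := fun e => wdeg ω ⇑e) fM
      fun e _ => exists_monomial_remainder mo hT hω e
    have hsI : f - (fM - r) ∈ I := I.sub_mem hf hrI
    have hs0 : f - (fM - r) = 0 := by
      by_contra hne
      obtain ⟨g, hg, hle⟩ := hGB _ hsI hne
      have hl := mem_support_iff.1 (leadExp_spec mo hne).1
      have hlM : leadExp mo (f - (fM - r)) ∈ M := ⟨g, hg, hle⟩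
      set l := leadExp mo (f - (fM - r))
      have hrl : r.coeff l = 0 := by
        by_contra h
        exact (hr l (mem_support_iff.2 h)).1 hlM
      rw [coeff_sub, coeff_sub, hrl, hcoeff] at hl
      by_cases h : f.coeff l = 0 <;> simp [h, hlM] at hl
    have hrd : r.coeff d ≠ 0 := by
      intro h
      have := congrArg (coeff d) hs0
      rw [coeff_sub, coeff_sub, h, hcoeff, if_neg (fun h => hdM h.2)] at this
      exact mem_support_iff.1 hdf (by simpa using this)
    obtain ⟨-, e, he, h | h⟩ := hr d (mem_support_iff.2 hrd)
    · exact hdM (h ▸ (hsupp e he).2)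
    · exact absurd h (not_lt.2 (hdmax e (hsupp e he).1))
  · refine Ideal.span_le.2 ?_
    rintro _ ⟨f, hf, rfl⟩
    refine mem_of_support _ (fun g hg => ?_) _ fun d hd => ?_
    · rw [← initForm_eq_leadTerm mo (hT g hg).2 (hω g hg)]
      exact Ideal.subset_span ⟨g, (hT g hg).1, rfl⟩
    · obtain rfl : d = leadExp mo f := by
        simpa using support_monomial_subset (by simpa only [leadTerm] using hd)
      refine hGB f hf ?_
      rintro rfl
      simp [leadTerm] at hd

/-- The perturbation of `ω` by the weights `ε ^ (N - i)`, which favours later variables. -/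
noncomputable def perturb (ω : Fin N → ℝ) (ε : ℝ) (i : Fin N) : ℝ :=
  ω i + ε ^ (N - (i : ℕ))

/-- An ultrafilter of positive reals converging to `0`. -/
noncomputable def zeroUltrafilter : Ultrafilter ℝ := Ultrafilter.of (𝓝[>] 0)

theorem zeroUltrafilter_le : (zeroUltrafilter : Filter ℝ) ≤ 𝓝[>] 0 := Ultrafilter.of_le _

theorem eventually_pos_zeroUltrafilter : ∀ᶠ ε in (zeroUltrafilter : Filter ℝ), 0 < ε :=
  zeroUltrafilter_le self_mem_nhdsWithin

theorem eq_of_eventually_wdeg_perturb_eq (ω : Fin N → ℝ) (a b : Fin N →₀ ℕ)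
    (h : ∀ᶠ ε in (zeroUltrafilter : Filter ℝ),
      wdeg (perturb ω ε) ⇑a = wdeg (perturb ω ε) ⇑b) : a = b := by
  classical
  set P : Polynomial ℝ := ∑ i : Fin N, (Polynomial.C (ω i * ((a i : ℝ) - b i)) +
    Polynomial.C ((a i : ℝ) - b i) * Polynomial.X ^ (N - (i : ℕ))) with hP
  have heval : ∀ ε, P.eval ε = wdeg (perturb ω ε) ⇑a - wdeg (perturb ω ε) ⇑b := by
    intro ε
    simp only [hP, Polynomial.eval_finsetSum, wdeg, perturb, ← Finset.sum_sub_distrib]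
    refine Finset.sum_congr rfl fun i _ => ?_
    simp
    ring
  have hP0 : P = 0 := by
    by_contra hne
    have hfin : {x | P.IsRoot x}.Finite := Polynomial.finite_setOfPred_isRoot hne
    have hle : (zeroUltrafilter : Filter ℝ) ≤ cofinite :=
      zeroUltrafilter_le.trans ((nhdsGT_le_nhdsNE 0).trans (nhdsNE_le_cofinite 0))
    have hnot : ∀ᶠ ε in (zeroUltrafilter : Filter ℝ), ¬ P.IsRoot ε :=
      hle hfin.compl_mem_cofinite
    obtain ⟨ε, h1, h2⟩ := (h.and hnot).exists
    exact h2 (by rw [Polynomial.IsRoot.def, heval, h1, sub_self])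
  ext k
  have hk := congrArg (fun p => Polynomial.coeff p (N - (k : ℕ))) hP0
  have hpos : N - (k : ℕ) ≠ 0 := by omega
  simp only [hP, Polynomial.finsetSum_coeff, Polynomial.coeff_add, Polynomial.coeff_C,
    if_neg hpos, zero_add, Polynomial.coeff_C_mul, Polynomial.coeff_X_pow,
    Polynomial.coeff_zero] at hk
  rw [Finset.sum_eq_single k] at hk
  · simp only [if_true, mul_one] at hk
    exact_mod_cast sub_eq_zero.1 hk
  · intro i _ hik
    have : N - (k : ℕ) ≠ N - (i : ℕ) := fun h => hik (Fin.ext (by omega))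
    simp [this]
  · simp

/-- Comparison of exponents by their weights under arbitrarily small perturbations of `ω`. -/
noncomputable def perturbOrder (ω : Fin N → ℝ) (hω : ∀ i, 0 ≤ ω i) : MonoOrder N where
  lt a b := ∀ᶠ ε in (zeroUltrafilter : Filter ℝ),
    wdeg (perturb ω ε) ⇑a < wdeg (perturb ω ε) ⇑b
  total a b := by
    have h : ∀ᶠ ε in (zeroUltrafilter : Filter ℝ),
        wdeg (perturb ω ε) ⇑a = wdeg (perturb ω ε) ⇑b ∨
        (wdeg (perturb ω ε) ⇑a < wdeg (perturb ω ε) ⇑b ∨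
          wdeg (perturb ω ε) ⇑b < wdeg (perturb ω ε) ⇑a) :=
      Eventually.of_forall fun ε => by
        rcases lt_trichotomy (wdeg (perturb ω ε) ⇑a) (wdeg (perturb ω ε) ⇑b) with h | h | h <;>
          simp [h]
    rw [Ultrafilter.eventually_or, Ultrafilter.eventually_or] at h
    exact h.imp_left (eq_of_eventually_wdeg_perturb_eq ω a b)
  trans a b c hab hbc := by
    filter_upwards [hab, hbc] with ε h1 h2 using h1.trans h2
  irrefl a h := by
    obtain ⟨ε, hε⟩ := h.exists
    exact lt_irrefl _ hε
  add_right a b c h := by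
    filter_upwards [h] with ε hε
    rw [wdeg_add, wdeg_add]
    linarith
  zero_lt a ha := by
    filter_upwards [eventually_pos_zeroUltrafilter] with ε hε
    have hw : ∀ i, 0 < perturb ω ε i := fun i => add_pos_of_nonneg_of_pos (hω i) (pow_pos hε _)
    obtain ⟨i, hi⟩ := Finsupp.ne_iff.1 ha
    have h0 : wdeg (perturb ω ε) ⇑(0 : Fin N →₀ ℕ) = 0 := by simp [wdeg]
    rw [h0]
    refine Finset.sum_pos' (fun j _ => mul_nonneg (hw j).le (Nat.cast_nonneg _))
      ⟨i, Finset.mem_univ i, mul_pos (hw i) ?_⟩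
    exact_mod_cast Nat.pos_of_ne_zero hi

theorem perturbOrder_lt_iff {ω : Fin N → ℝ} {hω : ∀ i, 0 ≤ ω i} {a b : Fin N →₀ ℕ} :
    (perturbOrder ω hω).lt a b ↔ ∀ᶠ ε in (zeroUltrafilter : Filter ℝ),
      wdeg (perturb ω ε) ⇑a < wdeg (perturb ω ε) ⇑b := Iff.rfl

theorem tendsto_perturb (ω : Fin N → ℝ) :
    Tendsto (perturb ω) (zeroUltrafilter : Filter ℝ) (𝓝 ω) := by
  refine Tendsto.mono_left ?_ (zeroUltrafilter_le.trans nhdsWithin_le_nhds)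
  refine tendsto_pi_nhds.2 fun i => ?_
  have hc : Continuous fun ε : ℝ => perturb ω ε i := by unfold perturb; fun_prop
  have h0 : perturb ω 0 i = ω i := by
    have : N - (i : ℕ) ≠ 0 := by omega
    simp [perturb, this]
  simpa only [h0] using hc.tendsto 0

/-- If `ω` vanishes on the first `n` variables, then `perturbOrder ω` is an elimination order. -/
theorem eq_zero_of_perturbOrder_lt {n : ℕ} {ω : Fin N → ℝ} (hω : ∀ i, 0 ≤ ω i)
    (hωn : ∀ i : Fin N, (i : ℕ) < n → ω i = 0) {e d : Fin N →₀ ℕ}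
    (hlt : (perturbOrder ω hω).lt e d) (hd : ∀ i : Fin N, n ≤ (i : ℕ) → d i = 0)
    (i : Fin N) (hi : n ≤ (i : ℕ)) : e i = 0 := by
  by_contra hei
  set S : ℝ := ∑ j, (d j : ℝ) with hS
  have hsmall : ∀ᶠ ε in (zeroUltrafilter : Filter ℝ), ε * S < 1 ∧ ε < 1 := by
    refine (zeroUltrafilter_le.trans nhdsWithin_le_nhds) ?_
    have h1 : Tendsto (fun ε : ℝ => ε * S) (𝓝 0) (𝓝 0) := by
      simpa using (continuous_mul_const S).tendsto 0
    exact (h1.eventually_lt_const one_pos).and (eventually_lt_nhds one_pos)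
  obtain ⟨ε, ⟨⟨hεS, hε1⟩, hε⟩, hεlt⟩ :=
    ((hsmall.and eventually_pos_zeroUltrafilter).and (perturbOrder_lt_iff.1 hlt)).exists
  have hw : ∀ j, 0 < perturb ω ε j := fun j => add_pos_of_nonneg_of_pos (hω j) (pow_pos hε _)
  have hlow : ε ^ (N - n) ≤ wdeg (perturb ω ε) ⇑e := by
    have h1 : (1 : ℝ) ≤ e i := by exact_mod_cast Nat.one_le_iff_ne_zero.2 hei
    calc ε ^ (N - n) ≤ ε ^ (N - (i : ℕ)) :=
          pow_le_pow_of_le_one hε.le hε1.le (by omega)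
      _ ≤ perturb ω ε i := le_add_of_nonneg_left (hω i)
      _ ≤ perturb ω ε i * e i := le_mul_of_one_le_right (hw i).le h1
      _ ≤ wdeg (perturb ω ε) ⇑e :=
          Finset.single_le_sum (f := fun j => perturb ω ε j * (e j : ℝ))
            (fun j _ => mul_nonneg (hw j).le (Nat.cast_nonneg _)) (Finset.mem_univ i)
  have hup : wdeg (perturb ω ε) ⇑d ≤ ε ^ (N - n) * (ε * S) := by
    rw [← mul_assoc, ← pow_succ, hS, Finset.mul_sum]
    refine Finset.sum_le_sum fun j _ => ?_
    by_cases hj : (j : ℕ) < n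
    · refine mul_le_mul_of_nonneg_right ?_ (Nat.cast_nonneg _)
      rw [perturb, hωn j hj, zero_add]
      exact pow_le_pow_of_le_one hε.le hε1.le (by omega)
    · simp [hd j (not_lt.1 hj)]
  have := mul_lt_of_lt_one_right (pow_pos hε (N - n)) hεS
  linarith

/-- Every weight vector of `Ω_u` (zero on the first `n` coordinates) is
an `I`-specific elimination vector: it lies in `C_≺(I)` for some `I`-EO `≺`. -/
theorem OmegaU_subset_EV (n m : ℕ) {K : Type*} [Field K]
    (I : Ideal (MvPolynomial (Fin (n + m)) K)) :
    ∀ ω ∈ OmegaU n (n + m), IsEV n I ω := by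
  rintro ω ⟨hω, hωn⟩
  set mo := perturbOrder ω hω with hmo
  refine ⟨hω, mo, ?_, ?_⟩
  · rintro G ⟨-, -, -, hG, -⟩ g hg hlead
    obtain ⟨hg0, hg1⟩ := hG g hg
    have hd : ∀ i : Fin (n + m), n ≤ (i : ℕ) → leadExp mo g i = 0 := by
      refine hlead _ ?_
      rw [leadTerm, hg1, mem_support_iff, coeff_monomial, if_pos rfl]
      exact one_ne_zero
    intro e he i hi
    by_cases hne : e = leadExp mo g
    · exact hne ▸ hd i hi
    · exact eq_zero_of_perturbOrder_lt hω hωn ((leadExp_spec mo hg0).2 e he hne) hd i hi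
  · obtain ⟨T, hT, hGB⟩ := exists_finset_leadExp_le mo I
    refine mem_closure_of_tendsto (tendsto_perturb ω) ?_
    have hsep : ∀ᶠ ε in (zeroUltrafilter : Filter ℝ), ∀ g ∈ T, ∀ e ∈ g.support,
        e ≠ leadExp mo g → wdeg (perturb ω ε) ⇑e < wdeg (perturb ω ε) ⇑(leadExp mo g) := by
      refine (eventually_all_finset T).2 fun g hg =>
        (eventually_all_finset g.support).2 fun e he => ?_
      by_cases hne : e = leadExp mo g
      · exact Eventually.of_forall fun ε h => absurd hne h
      · filter_upwards [perturbOrder_lt_iff.1 ((leadExp_spec mo (hT g hg).2).2 e he hne)]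
          with ε hε _ using hε
    filter_upwards [hsep, eventually_pos_zeroUltrafilter] with ε h hε
    exact ⟨fun i => add_nonneg (hω i) (pow_nonneg hε.le _), ltIdealW_eq_ltIdealO mo hT hGB h⟩
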